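/- Let g : [n]^{a+b} → {-1,0,1}^{a+b+1} satisfy the Tarski* conditions, and fix q ∈ [n]^b and j ∈ [a+b+1] \ [a]. Define g_j : [n]^a → {-1,0,1}^{a+1} by g_j(x) = (g(x,q)_1, …, g(x,q)_a, g(x,q)_j). Then g_j satisfies the Tarski* conditions on [n]^a (with k = a). -/

import Mathlib

/-- `x` lies in the grid `[n]^k = {1,...,n}^k` (coordinates as integers). -/
def inGrid (n : ℕ) {k : ℕ} (x : Fin k → ℤ) : Prop :=
  ∀ i, 1 ≤ x i ∧ x i ≤ (n : ℤ)

/-- The Tarski* conditions for `g : [n]^k → {-1,0,1}^{k+1}`. -/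
def TarskiStarConds (n k : ℕ) (g : (Fin k → ℤ) → Fin (k + 1) → ℤ) : Prop :=
  (∀ x, inGrid n x → ∀ j, g x j = -1 ∨ g x j = 0 ∨ g x j = 1) ∧
  (∀ x, inGrid n x → ∀ i : Fin k, 1 ≤ x i + g x i.castSucc ∧ x i + g x i.castSucc ≤ (n : ℤ)) ∧
  (∀ x y, inGrid n x → inGrid n y → x ≤ y →
    (Fin.snoc x 0 : Fin (k + 1) → ℤ) + g x ≤ (Fin.snoc y 0 : Fin (k + 1) → ℤ) + g y)
theorem inGrid.append {n a b : ℕ} {x : Fin a → ℤ} {q : Fin b → ℤ}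
    (hx : inGrid n x) (hq : inGrid n q) : inGrid n (Fin.append x q) := by
  intro i
  induction i using Fin.addCases with
  | left i => simpa using hx i
  | right i => simpa using hq i

theorem Fin.append_le_append_left {a b : ℕ} {x y : Fin a → ℤ} (h : x ≤ y) (q : Fin b → ℤ) :
    Fin.append x q ≤ Fin.append y q := by
  intro i
  induction i using Fin.addCases with
  | left i => simpa using h i
  | right i => simp

theorem Fin.snoc_append_eq_of_le {a b : ℕ} (x y : Fin a → ℤ) (q : Fin b → ℤ) (c : ℤ)
    (j : Fin (a + b + 1)) (hj : a ≤ (j : ℕ)) :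
    (Fin.snoc (Fin.append x q) c : Fin (a + b + 1) → ℤ) j =
      (Fin.snoc (Fin.append y q) c : Fin (a + b + 1) → ℤ) j := by
  induction j using Fin.lastCases with
  | last => simp
  | cast j =>
    induction j using Fin.addCases with
    | left i => exact absurd hj (by simp)
    | right i => simp only [Fin.snoc_castSucc, Fin.append_right]

theorem restricted_g_satisfies_tarskiStar (n a b : ℕ)
    (g : (Fin (a + b) → ℤ) → Fin (a + b + 1) → ℤ)
    (hg : TarskiStarConds n (a + b) g)
    (q : Fin b → ℤ) (hq : inGrid n q)
    (j : Fin (a + b + 1)) (hj : a ≤ (j : ℕ))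
    (gj : (Fin a → ℤ) → Fin (a + 1) → ℤ)
    (hgj : ∀ x : Fin a → ℤ, gj x =
      Fin.snoc (fun i : Fin a => g (Fin.append x q) (Fin.castLE (by omega) i))
        (g (Fin.append x q) j)) :
    TarskiStarConds n a gj := by
  obtain ⟨hval, hrange, hmono⟩ := hg
  have hcast (i : Fin a) :
      Fin.castLE (by omega : a ≤ a + b + 1) i = (Fin.castAdd b i).castSucc := rfl
  refine ⟨fun x hx i => ?_, fun x hx i => ?_, fun x y hx hy hxy i => ?_⟩
  · rw [hgj]
    induction i using Fin.lastCases with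
    | last => simpa using hval _ (hx.append hq) j
    | cast i => simpa using hval _ (hx.append hq) _
  · simpa [hgj, hcast] using hrange _ (hx.append hq) (Fin.castAdd b i)
  · have h := hmono _ _ (hx.append hq) (hy.append hq) (Fin.append_le_append_left hxy q)
    induction i using Fin.lastCases with
    | last =>
      have hlast := h j
      simp only [Pi.add_apply, Fin.snoc_append_eq_of_le x y q 0 j hj] at hlast
      simpa [hgj] using hlast
    | cast i => simpa [hgj, hcast] using h (Fin.castAdd b i).castSucc
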